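/- Let x ≥ 3 be odd, let t ≥ 2, and let L = {1^a, x^b, (tx)^c} be a multiset of size v − 1 = a + b + c with v ≥ (t+2)x. Let q = ⌊v/x⌋. If a ≥ ω(x, b+c) and b ≥ 2q + tx − 2t + 1, then L has a standard linear realization. -/

import Mathlib

/-- The multiset of absolute differences of consecutive entries of a list of naturals. -/
def linDiffs (l : List ℕ) : Multiset ℕ :=
  ↑(List.zipWith (fun a b => (a - b) + (b - a)) l l.tail)

/-- `l` is a linear realization of the multiset `L`: it lists `0, …, |L|`
(each exactly once) and its consecutive absolute differences form `L`. -/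
def IsLinearRealization (L : Multiset ℕ) (l : List ℕ) : Prop :=
  l.Perm (List.range (Multiset.card L + 1)) ∧ linDiffs l = L

def HasLinearRealization (L : Multiset ℕ) : Prop :=
  ∃ l : List ℕ, IsLinearRealization L l

/-- A standard linear realization starts at `0`. -/
def HasStandardLinearRealization (L : Multiset ℕ) : Prop :=
  ∃ l : List ℕ, IsLinearRealization L l ∧ l.head? = some 0

/-- A perfect linear realization starts at `0` and ends at `v - 1 = |L|`. -/
def HasPerfectLinearRealization (L : Multiset ℕ) : Prop :=
  ∃ l : List ℕ, IsLinearRealization L l ∧ l.head? = some 0 ∧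
    l.getLast? = some (Multiset.card L)

/-- The multiset of cyclic edge-lengths `min(|gᵢ₊₁ - gᵢ|, v - |gᵢ₊₁ - gᵢ|)`
of consecutive entries of a list of naturals. -/
def cycDiffs (v : ℕ) (l : List ℕ) : Multiset ℕ :=
  ↑(List.zipWith (fun a b => min ((a - b) + (b - a)) (v - ((a - b) + (b - a)))) l l.tail)

/-- `L` is (cyclically) realizable in `K_v`: some Hamiltonian path on the vertex
set `{0, …, v-1}` has `L` as its multiset of edge-lengths. -/
def IsRealizable (v : ℕ) (L : Multiset ℕ) : Prop :=
  ∃ l : List ℕ, l.Perm (List.range v) ∧ cycDiffs v l = L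

/-- The multiset `{1^a, x^b, y^c}`. -/
def mset3 (a b c x y : ℕ) : Multiset ℕ :=
  Multiset.replicate a 1 + Multiset.replicate b x + Multiset.replicate c y

/-- With `b = q'x + r'`, `0 ≤ r' < x`: `ω(x,b) = x - 1` if `q' = 0`, `r' = 1`,
or at least one of `x`, `r'` is even; otherwise `ω(x,b) = x`. -/
def omegaBHR (x b : ℕ) : ℕ :=
  if b / x = 0 ∨ b % x = 1 ∨ Even x ∨ Even (b % x) then x - 1 else x

/-- The reduced form `ĝ = min(g, v - g)`. -/
def reducedForm (v g : ℕ) : ℕ := min g (v - g)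

/-- The function `f` of Theorem 3.7 (counterexample characterization refined). -/
def fBHR (u w : ℕ) : ℕ :=
  if Even u ∧ Even w then w - 1
  else if u = 3 ∨ (Even u ∧ ¬ Even w) then u + w - 2
  else u + w - 1

/-- A multiset `L` of size `v - 1` with elements in `{1, …, ⌊v/2⌋}` is admissible
if for every divisor `d` of `v` the number of elements of `L` divisible by `d`
is at most `v - d`. -/
def IsAdmissible (v : ℕ) (L : Multiset ℕ) : Prop :=
  Multiset.card L = v - 1 ∧ (∀ z ∈ L, 1 ≤ z ∧ z ≤ v / 2) ∧
  ∀ d : ℕ, d ∣ v → Multiset.card (L.filter (fun z => d ∣ z)) ≤ v - d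

/-- `IsPath S s e D`: the elements of `S` can be arranged in a sequence from `s` to `e` whose
consecutive absolute differences form `D`. -/
inductive IsPath : Multiset ℕ → ℕ → ℕ → Multiset ℕ → Prop
  | single (n : ℕ) : IsPath {n} n n 0
  | append {S S' D D' : Multiset ℕ} {s e s' e' : ℕ} :
      IsPath S s e D → IsPath S' s' e' D' → IsPath (S + S') s e' (D + D' + {Nat.dist e s'})

lemma IsPath.append' {S S' D D' T E : Multiset ℕ} {s e s' e' : ℕ} (h : IsPath S s e D)
    (h' : IsPath S' s' e' D') (hT : T = S + S') (hE : E = D + D' + {Nat.dist e s'}) :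
    IsPath T s e' E := by
  subst hT hE
  exact h.append h'

lemma IsPath.card {S D : Multiset ℕ} {s e : ℕ} (h : IsPath S s e D) :
    Multiset.card S = Multiset.card D + 1 := by
  induction h with
  | single n => simp
  | append _ _ ih ih' => simp only [Multiset.card_add, ih, ih', Multiset.card_singleton]; omega

lemma IsPath.reverse {S D : Multiset ℕ} {s e : ℕ} (h : IsPath S s e D) : IsPath S e s D := by
  induction h with
  | single n => exact .single n
  | append _ _ ih ih' =>
    refine ih'.append' ih (add_comm _ _) ?_
    rw [Nat.dist_comm]
    abel

/-- Affine images of paths. -/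
lemma IsPath.map {S D : Multiset ℕ} {s e : ℕ} (h : IsPath S s e D) (x i : ℕ) :
    IsPath (S.map fun k => k * x + i) (s * x + i) (e * x + i) (D.map fun k => k * x) := by
  induction h with
  | single n => exact .single _
  | append _ _ ih ih' =>
    refine ih.append' ih' (by simp) ?_
    simp [Nat.dist_add_add_right, Nat.dist_mul_right]

lemma range_succ_eq_zero_add (n : ℕ) :
    Multiset.range (n + 1) = {0} + (Multiset.range n).map fun k => k * 1 + 1 := by
  have h := congrArg (fun l : List ℕ => (l : Multiset ℕ)) (List.range_succ_eq_map (n := n))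
  simpa [Multiset.range, Multiset.singleton_add] using h

/-- A standard path can be preceded by a step of length `1`. -/
lemma IsPath.prepend {n e : ℕ} {D : Multiset ℕ} (h : IsPath (Multiset.range n) 0 e D) :
    IsPath (Multiset.range (n + 1)) 0 (e + 1) (D + {1}) := by
  have h1 := h.map 1 1
  simp only [mul_one, Multiset.map_id', zero_add] at h1
  refine (IsPath.single 0).append' h1 ?_ (by simp [Nat.dist])
  simpa using range_succ_eq_zero_add n

lemma linDiffs_append (l l' : List ℕ) (e s : ℕ) (he : l.getLast? = some e)
    (hs : l'.head? = some s) :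
    linDiffs (l ++ l') = linDiffs l + linDiffs l' + {Nat.dist e s} := by
  induction l with
  | nil => simp at he
  | cons u l ih =>
    cases l with
    | nil =>
      cases l' with
      | nil => simp at hs
      | cons w l' =>
        simp only [List.getLast?_singleton, Option.some.injEq, List.head?_cons] at he hs
        subst he hs
        simp only [linDiffs, Nat.dist, List.cons_append, List.nil_append, List.tail_cons,
          List.zipWith_cons_cons, List.zipWith_nil_right, Multiset.coe_nil, zero_add]
        rw [← Multiset.cons_coe, ← Multiset.singleton_add, add_comm]
    | cons w l =>
      have h2 := ih (by simpa using he)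
      simp only [linDiffs, List.cons_append, List.tail_cons, List.zipWith_cons_cons,
        ← Multiset.cons_coe] at h2 ⊢
      rw [h2, Multiset.cons_add, Multiset.cons_add]

lemma IsPath.exists_list {S D : Multiset ℕ} {s e : ℕ} (h : IsPath S s e D) :
    ∃ l : List ℕ, (l : Multiset ℕ) = S ∧ l.head? = some s ∧ l.getLast? = some e ∧
      linDiffs l = D := by
  induction h with
  | single n => exact ⟨[n], by simp [linDiffs]⟩
  | append _ _ ih ih' =>
    obtain ⟨l, h1, h2, h3, h4⟩ := ih
    obtain ⟨l', h1', h2', h3', h4'⟩ := ih'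
    refine ⟨l ++ l', by rw [← Multiset.coe_add, h1, h1'], ?_, ?_, ?_⟩
    · simp [List.head?_append, h2]
    · simp [List.getLast?_append, h3']
    · rw [linDiffs_append l l' _ _ h3 h2', h4, h4']

lemma IsPath.hasStandardLinearRealization {n e : ℕ} {D : Multiset ℕ}
    (h : IsPath (Multiset.range n) 0 e D) : HasStandardLinearRealization D := by
  have hc := h.card
  rw [Multiset.card_range] at hc
  obtain ⟨l, h1, h2, -, h4⟩ := h.exists_list
  refine ⟨l, ⟨?_, h4⟩, h2⟩
  rw [← hc]
  exact Multiset.coe_eq_coe.1 h1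

lemma mset3_add (a b c a' b' c' x y : ℕ) :
    mset3 a b c x y + mset3 a' b' c' x y = mset3 (a + a') (b + b') (c + c') x y := by
  simp only [mset3, Multiset.replicate_add]
  abel

lemma mset3_add_one (a b c x y : ℕ) : mset3 a b c x y + {1} = mset3 (a + 1) b c x y := by
  simp only [mset3, Multiset.replicate_add, Multiset.replicate_one]
  abel

lemma card_mset3 (a b c x y : ℕ) : Multiset.card (mset3 a b c x y) = a + b + c := by
  simp [mset3]

/-- A path with `a` differences `1`, `c` differences `y`, and all others equal to `x`. -/
def TriPath (x y : ℕ) (S : Multiset ℕ) (s e a c : ℕ) : Prop :=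
  ∃ b, IsPath S s e (mset3 a b c x y)

lemma TriPath.join {x y s e a c s' e' a' c' : ℕ} {S S' : Multiset ℕ}
    (h : TriPath x y S s e a c) (h' : TriPath x y S' s' e' a' c') (hd : Nat.dist e s' = 1) :
    TriPath x y (S + S') s e' (a + a' + 1) (c + c') := by
  obtain ⟨b, h⟩ := h
  obtain ⟨b', h'⟩ := h'
  refine ⟨b + b', h.append' h' rfl ?_⟩
  rw [hd, mset3_add, mset3_add_one]

lemma TriPath.congr {x y s e a c a' c' : ℕ} {S S' : Multiset ℕ} (h : TriPath x y S s e a c)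
    (hS : S = S') (ha : a = a') (hc : c = c') : TriPath x y S' s e a' c' := by
  subst hS ha hc
  exact h

lemma TriPath.reverse {x y s e a c : ℕ} {S : Multiset ℕ} (h : TriPath x y S s e a c) :
    TriPath x y S e s a c :=
  h.imp fun _ h => h.reverse

lemma TriPath.single (x y n : ℕ) : TriPath x y {n} n n 0 0 :=
  ⟨0, by simpa [mset3] using IsPath.single n⟩

/-- `m` points can be traversed from the bottom to `e` with `γ` steps `t`, the others being `1`. -/
def ColPath (t m γ e : ℕ) : Prop := TriPath 1 t (Multiset.range m) 0 e 0 γ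

lemma ColPath.prepend {t m γ e : ℕ} (h : ColPath t m γ e) : ColPath t (m + 1) γ (e + 1) := by
  obtain ⟨b, h⟩ := h
  refine ⟨b + 1, ?_⟩
  convert h.prepend using 1
  simp only [mset3, Multiset.replicate_add, Multiset.replicate_one]
  abel

lemma colPath_straight (t q : ℕ) : ColPath t (q + 1) 0 q := by
  induction q with
  | zero => exact TriPath.single 1 t 0
  | succ q ih => exact ih.prepend

/-- The first `m` numbers congruent to `i` modulo `x`. -/
def column (x i m : ℕ) : Multiset ℕ := (Multiset.range m).map fun k => k * x + i

lemma ColPath.toTriPath {t m γ e : ℕ} (h : ColPath t m γ e) (x i : ℕ) :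
    TriPath x (t * x) (column x i m) i (e * x + i) 0 γ := by
  obtain ⟨b, h⟩ := h
  refine ⟨b, ?_⟩
  convert h.map x i using 1
  · rfl
  · simp
  · simp [mset3]

lemma ColPath.column_pair {t m γ e : ℕ} (h : ColPath t m γ e) (x : ℕ) {i j : ℕ}
    (hij : Nat.dist i j = 1) :
    TriPath x (t * x) (column x i m + column x j m) i j 1 (2 * γ) := by
  have := (h.toTriPath x i).join (h.toTriPath x j).reverse (by rwa [Nat.dist_add_add_left])
  exact this.congr rfl rfl (two_mul γ).symm

lemma ColPath.outer_pair {t q γ e : ℕ} (h : ColPath t q γ e) {x : ℕ} (hx : 1 ≤ x) :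
    TriPath x (t * x) (column x 0 (q + 1) + column x (x - 1) q) 0 (x - 1) 1
      (2 * γ) := by
  have := (h.prepend.toTriPath x 0).join (h.toTriPath x (x - 1)).reverse (by
    rw [add_mul, one_mul, add_zero, Nat.dist_add_add_left]
    simp only [Nat.dist]
    omega)
  exact this.congr rfl rfl (two_mul γ).symm

/-- The numbers below `v` whose residue modulo `x` lies in `[lo, hi)`. -/
def block (x v lo hi : ℕ) : Multiset ℕ :=
  (Multiset.range v).filter fun n => lo ≤ n % x ∧ n % x < hi

lemma block_add {x v lo mid hi : ℕ} (h1 : lo ≤ mid) (h2 : mid ≤ hi) :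
    block x v lo mid + block x v mid hi = block x v lo hi := by
  unfold block
  rw [← Multiset.filter_add_not (fun n => n % x < mid)
    ((Multiset.range v).filter fun n => lo ≤ n % x ∧ n % x < hi), Multiset.filter_filter,
    Multiset.filter_filter]
  congr 1 <;> apply Multiset.filter_congr <;> intro n _ <;> omega

lemma block_full {x v : ℕ} (hx : 0 < x) : block x v 0 x = Multiset.range v := by
  unfold block
  rw [Multiset.filter_eq_self]
  intro n _
  exact ⟨Nat.zero_le _, Nat.mod_lt _ hx⟩

lemma block_eq_column {x v i m : ℕ} (hi : i < x) (h : ∀ k, k * x + i < v ↔ k < m) :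
    block x v i (i + 1) = column x i m := by
  have hx : 0 < x := by omega
  unfold block column
  refine (Multiset.Nodup.ext ((Multiset.nodup_range v).filter _) ?_).2 ?_
  · refine (Multiset.nodup_range m).map fun u w huw => ?_
    have : u * x = w * x := by simpa using huw
    exact Nat.eq_of_mul_eq_mul_right hx this
  · intro n
    simp only [Multiset.mem_filter, Multiset.mem_range, Multiset.mem_map]
    constructor
    · rintro ⟨hn, h1, h2⟩
      have h3 : n / x * x + i = n := by
        have := Nat.div_add_mod' n x
        omega
      exact ⟨n / x, (h _).1 (by rwa [h3]), h3⟩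
    · rintro ⟨k, hk, rfl⟩
      rw [Nat.add_comm, Nat.add_mul_mod_self_right, Nat.mod_eq_of_lt hi, Nat.add_comm]
      exact ⟨(h k).2 hk, by omega, by omega⟩

lemma block_long {x q r i : ℕ} (hr : r < x) (hi : i < r) :
    block x (q * x + r) i (i + 1) = column x i (q + 1) := by
  refine block_eq_column (hi.trans hr) fun k => ⟨fun h => ?_, fun h => ?_⟩
  · by_contra! hk
    nlinarith [Nat.mul_le_mul_right x hk]
  · nlinarith [Nat.mul_le_mul_right x (Nat.le_of_lt_succ h)]

lemma block_short {x q r i : ℕ} (hi : i < x) (hr : r ≤ i) :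
    block x (q * x + r) i (i + 1) = column x i q := by
  refine block_eq_column hi fun k => ⟨fun h => ?_, fun h => ?_⟩
  · by_contra! hk
    nlinarith [Nat.mul_le_mul_right x hk]
  · nlinarith [Nat.mul_le_mul_right x (Nat.succ_le_of_lt h)]

/-- Every number of steps `t` up to `K` can occur in a path through `m` points. -/
def ColCap (t m K : ℕ) : Prop := ∀ γ ≤ K, ∃ e, ColPath t m γ e

lemma colCap_zero (t : ℕ) {m : ℕ} (hm : 0 < m) : ColCap t m 0 := by
  obtain ⟨q, rfl⟩ : ∃ q, m = q + 1 := ⟨m - 1, by omega⟩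
  intro γ hγ
  obtain rfl : γ = 0 := by omega
  exact ⟨q, colPath_straight t q⟩

lemma TriPath.pairs_up {x t v m K s a c lo k g : ℕ} {S : Multiset ℕ}
    (hS : TriPath x (t * x) S s lo a c) (hK : ColCap t m K)
    (hcol : ∀ i, lo < i → i ≤ lo + 2 * k → block x v i (i + 1) = column x i m)
    (hg : g ≤ k * K) :
    TriPath x (t * x) (S + block x v (lo + 1) (lo + 2 * k + 1)) s (lo + 2 * k) (a + 2 * k)
      (c + 2 * g) := by
  induction k generalizing g with
  | zero =>
    obtain rfl : g = 0 := by omega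
    have : block x v (lo + 1) (lo + 1) = 0 := by
      unfold block
      rw [Multiset.filter_eq_nil]
      intro n _
      omega
    simpa [this] using hS
  | succ k ih =>
    rw [add_mul, one_mul] at hg
    obtain ⟨γ, g', hγ, hg', rfl⟩ : ∃ γ g', γ ≤ K ∧ g' ≤ k * K ∧ g = γ + g' :=
      ⟨min g K, g - min g K, by omega, by omega, by omega⟩
    obtain ⟨e, he⟩ := hK γ hγ
    have h1 := ih (fun i hi hi' => hcol i hi (by omega)) hg'
    have h2 := he.column_pair x (i := lo + 2 * k + 1) (j := lo + 2 * k + 2)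
      (by simp only [Nat.dist]; omega)
    rw [← hcol _ (by omega) (by omega), ← hcol _ (by omega) (by omega),
      block_add (by omega) (by omega)] at h2
    have h3 := h1.join h2 (by simp only [Nat.dist]; omega)
    rw [add_assoc S, block_add (by omega) (by omega)] at h3
    exact h3.congr rfl (by ring) (by ring)

lemma TriPath.pairs_down {x t v m K s a c lo k g : ℕ} {S : Multiset ℕ}
    (hS : TriPath x (t * x) S s (lo + 2 * k) a c) (hK : ColCap t m K)
    (hcol : ∀ i, lo ≤ i → i < lo + 2 * k → block x v i (i + 1) = column x i m)
    (hg : g ≤ k * K) :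
    TriPath x (t * x) (S + block x v lo (lo + 2 * k)) s lo (a + 2 * k) (c + 2 * g) := by
  induction k generalizing g lo with
  | zero =>
    obtain rfl : g = 0 := by omega
    have : block x v lo lo = 0 := by
      unfold block
      rw [Multiset.filter_eq_nil]
      intro n _
      omega
    simpa [this] using hS
  | succ k ih =>
    rw [add_mul, one_mul] at hg
    obtain ⟨γ, g', hγ, hg', rfl⟩ : ∃ γ g', γ ≤ K ∧ g' ≤ k * K ∧ g = γ + g' :=
      ⟨min g K, g - min g K, by omega, by omega, by omega⟩
    obtain ⟨e, he⟩ := hK γ hγ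
    have h1 := ih (lo := lo + 2) (by convert hS using 1; ring)
      (fun i hi hi' => hcol i (by omega) (by omega)) hg'
    have h2 := he.column_pair x (i := lo + 1) (j := lo) (by simp only [Nat.dist]; omega)
    rw [← hcol _ (by omega) (by omega), ← hcol _ (by omega) (by omega), add_comm,
      block_add (by omega) (by omega)] at h2
    have h3 := h1.join h2 (by simp only [Nat.dist]; omega)
    rw [add_assoc S, add_comm (block _ _ _ _), block_add (by omega) (by omega)] at h3
    exact h3.congr (by congr 2; ring) (by ring) (by ring)

lemma colPath_one {t : ℕ} (ht : 1 ≤ t) : ∃ e, ColPath t (t + 1) 1 e := by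
  obtain ⟨q, rfl⟩ : ∃ q, t = q + 1 := ⟨t - 1, by omega⟩
  obtain ⟨b, hb⟩ := colPath_straight (q + 1) q
  have h := (hb.map 1 1).reverse
  refine ⟨1, b, (IsPath.single 0).append' h (range_succ_eq_zero_add _) ?_⟩
  simp [mset3, Nat.dist]

/-- Traversing the columns `0, x - 1, x - 2, …, lo` in this order. -/
lemma exists_triPath_down {x t q r lo k₁ k₂ K₁ K₂ γ g₁ g₂ : ℕ} (hr : r < x) (hr0 : 1 ≤ r)
    (hlo : 1 ≤ lo) (hx : lo + 2 * k₂ + 2 * k₁ + 1 = x) (hs : r ≤ lo + 2 * k₂)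
    (hl : k₂ = 0 ∨ lo + 2 * k₂ ≤ r) (h₁ : ColCap t q K₁) (h₂ : ColCap t (q + 1) K₂)
    (hγ : γ ≤ K₁) (hg₁ : g₁ ≤ k₁ * K₁) (hg₂ : g₂ ≤ k₂ * K₂) :
    TriPath x (t * x) (block x (q * x + r) 0 1 + block x (q * x + r) lo x) 0 lo
      (1 + 2 * k₁ + 2 * k₂) (2 * (γ + g₁ + g₂)) := by
  obtain ⟨e, he⟩ := h₁ γ hγ
  have h := he.outer_pair (x := x) (by omega)
  rw [← block_long hr (by omega : 0 < r), ← block_short (r := r) (by omega : x - 1 < x) (by omega),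
    (by omega : x - 1 = lo + 2 * k₂ + 2 * k₁)] at h
  have h' := h.pairs_down (v := q * x + r) (lo := lo + 2 * k₂) h₁
    (fun i hi hi' => block_short (by omega) (by omega)) hg₁
  have h'' := h'.pairs_down (v := q * x + r) h₂
    (fun i hi hi' => block_long hr (by omega)) hg₂
  refine h''.congr ?_ rfl (by ring)
  rw [← block_add (lo := lo) (mid := lo + 2 * k₂) (hi := x) (by omega) (by omega),
    ← block_add (lo := lo + 2 * k₂) (mid := lo + 2 * k₂ + 2 * k₁) (hi := x) (by omega) (by omega), hx]
  abel

/-- Traversing the columns `0, 1, …` in this order. -/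
lemma exists_triPath_up {x t v m₁ m₂ k₁ k₂ K₁ K₂ g₁ g₂ : ℕ} (hm : 0 < m₁)
    (hc₁ : ∀ i < 2 + 2 * k₁, block x v i (i + 1) = column x i m₁)
    (hc₂ : ∀ i, 2 + 2 * k₁ ≤ i → i < 2 + 2 * k₁ + 2 * k₂ →
      block x v i (i + 1) = column x i m₂)
    (h₁ : ColCap t m₁ K₁) (h₂ : ColCap t m₂ K₂)
    (hg₁ : g₁ ≤ k₁ * K₁) (hg₂ : g₂ ≤ k₂ * K₂) :
    TriPath x (t * x) (block x v 0 (2 + 2 * k₁ + 2 * k₂)) 0 (1 + 2 * k₁ + 2 * k₂)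
      (1 + 2 * k₁ + 2 * k₂) (2 * (g₁ + g₂)) := by
  obtain ⟨e, he⟩ := colCap_zero t hm 0 le_rfl
  have h := he.column_pair x (i := 0) (j := 1) (by simp [Nat.dist])
  rw [← hc₁ 0 (by omega), ← hc₁ 1 (by omega), block_add (by omega) (by omega)] at h
  have h' := h.pairs_up (v := v) h₁ (fun i hi hi' => hc₁ i (by omega)) hg₁
  rw [block_add (by omega) (by omega)] at h'
  have h'' := h'.pairs_up (v := v) h₂ (fun i hi hi' => hc₂ i (by omega) (by omega)) hg₂
  rw [block_add (by omega) (by omega)] at h''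
  convert h'' using 1
  · congr 1; ring
  · ring

/-- The case of an even remainder: the columns are traversed upwards in pairs. -/
lemma exists_triPath_of_even {x t q r K₁ K₂ g : ℕ} (hx : 2 ≤ x) (hq : 1 ≤ q) (hr : r < x)
    (hre : Even r) (h₁ : ColCap t q K₁) (h₂ : ColCap t (q + 1) K₂)
    (hg : g ≤ (r / 2 - 1) * K₂ + (x / 2 - max (r / 2) 1) * K₁) :
    TriPath x (t * x) (block x (q * x + r) 0 (2 * (x / 2))) 0 (2 * (x / 2) - 1)
      (2 * (x / 2) - 1) (2 * g) := by
  obtain ⟨g₁, g₂, hg₁, hg₂, rfl⟩ : ∃ g₁ g₂, g₁ ≤ (r / 2 - 1) * K₂ ∧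
      g₂ ≤ (x / 2 - max (r / 2) 1) * K₁ ∧ g = g₁ + g₂ :=
    ⟨min g ((r / 2 - 1) * K₂), g - min g ((r / 2 - 1) * K₂), by omega, by omega, by omega⟩
  obtain ⟨ρ, rfl⟩ := hre
  have e1 : 2 + 2 * ((ρ + ρ) / 2 - 1) + 2 * (x / 2 - max ((ρ + ρ) / 2) 1) = 2 * (x / 2) := by
    omega
  rw [(by omega : 2 * (x / 2) - 1 =
    1 + 2 * ((ρ + ρ) / 2 - 1) + 2 * (x / 2 - max ((ρ + ρ) / 2) 1)), ← e1]
  rcases Nat.eq_zero_or_pos ρ with rfl | hρ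
  · refine exists_triPath_up (m₁ := q) (m₂ := q) (K₁ := 0) hq
      (fun i hi => block_short (by omega) (by omega))
      (fun i hi hi' => block_short (by omega) (by omega)) (colCap_zero t hq) h₁ ?_ hg₂
    simpa using hg₁
  · exact exists_triPath_up (m₁ := q + 1) (m₂ := q) (Nat.succ_pos q)
      (fun i hi => block_long hr (by omega))
      (fun i hi hi' => block_short (by omega) (by omega)) h₂ h₁ hg₁ hg₂

lemma exists_triPath_odd_even {x t q r K₁ K₂ g γ e : ℕ} (hx : 2 ≤ x) (hxo : Odd x) (hq : 1 ≤ q)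
    (hr : r < x) (hre : Even r) (h₁ : ColCap t q K₁) (h₂ : ColCap t (q + 1) K₂)
    (hg : g ≤ (r / 2 - 1) * K₂ + (x / 2 - max (r / 2) 1) * K₁) (he : ColPath t q γ e) :
    ∃ e', TriPath x (t * x) (Multiset.range (q * x + r)) 0 e' (x - 1) (2 * g + γ) := by
  have h := exists_triPath_of_even hx hq hr hre h₁ h₂ hg
  obtain ⟨w, rfl⟩ := hxo
  obtain ⟨ρ, rfl⟩ := hre
  rw [(by omega : (2 * w + 1) / 2 = w)] at h
  have h' := he.toTriPath (2 * w + 1) (2 * w)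
  rw [← block_short (r := ρ + ρ) (by omega) (by omega)] at h'
  have h'' := h.join h' (by simp only [Nat.dist]; omega)
  rw [block_add (by omega) (by omega), block_full (by omega)] at h''
  exact ⟨_, h''.congr rfl (by omega) (by omega)⟩

lemma exists_triPath_odd_one {x t q K₁ g γ₀ γ e : ℕ} (hx : 3 ≤ x) (hxo : Odd x)
    (h₁ : ColCap t q K₁) (hγ : γ₀ ≤ K₁) (hg : g ≤ (x / 2 - 1) * K₁) (he : ColPath t q γ e) :
    ∃ e', TriPath x (t * x) (Multiset.range (q * x + 1)) 0 e' (x - 1) (2 * (γ₀ + g) + γ) := by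
  obtain ⟨w, rfl⟩ := hxo
  rw [(by omega : (2 * w + 1) / 2 = w)] at hg
  have h := exists_triPath_down (x := 2 * w + 1) (r := 1) (lo := 2) (k₁ := w - 1) (k₂ := 0)
    (by omega) le_rfl (by omega) (by omega) (by omega) (Or.inl rfl) h₁
    (colCap_zero t (Nat.succ_pos q)) hγ hg (Nat.zero_le _)
  have h' := he.toTriPath (2 * w + 1) 1
  rw [← block_short (r := 1) (by omega) (by omega)] at h'
  have h'' := h.join h' (by simp [Nat.dist])
  rw [add_right_comm, block_add (by omega) (by omega), block_add (by omega) (by omega),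
    block_full (by omega)] at h''
  exact ⟨_, h''.congr rfl (by omega) (by omega)⟩

/-- The last three columns `3`, `2`, `1`, traversed with one additional step of length `1`. -/
lemma exists_triPath_three_columns {x t q r γ e : ℕ} (hr : r < x) (hr4 : 4 ≤ r)
    (he : ColPath t q γ e) :
    ∃ e', TriPath x (t * x) (block x (q * x + r) 1 4) 3 e' 3 γ := by
  have h3 := (colPath_straight t q).toTriPath x 3
  have h2 := TriPath.single x (t * x) (q * x + 2)
  have h1 := ((colPath_straight t q).toTriPath x 1).reverse
  have h2' := he.toTriPath x 2
  have h := ((h3.join h2 (by rw [Nat.dist_add_add_left]; simp [Nat.dist])).join h1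
    (by rw [Nat.dist_add_add_left]; simp [Nat.dist])).join h2' (by simp [Nat.dist])
  refine ⟨_, h.congr ?_ (by ring) (by ring)⟩
  rw [← block_add (mid := 2) (by omega) (by omega),
    ← block_add (lo := 2) (mid := 3) (by omega) (by omega), block_long hr (by omega),
    block_long hr (by omega), block_long hr (by omega)]
  have : column x 2 (q + 1) = {q * x + 2} + column x 2 q := by
    simp [column, Multiset.range_succ]
  rw [this]
  abel

lemma exists_triPath_odd_extra {x t q r K₁ K₂ g₁ g₂ γ₀ γ e : ℕ} (hxo : Odd x) (hr : r < x)
    (hr4 : 4 ≤ r) (hre : Even r) (h₁ : ColCap t q K₁) (h₂ : ColCap t (q + 1) K₂) (hγ : γ₀ ≤ K₁)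
    (hg₁ : g₁ ≤ ((x - r) / 2) * K₁) (hg₂ : g₂ ≤ (r / 2 - 2) * K₂) (he : ColPath t q γ e) :
    ∃ e', TriPath x (t * x) (Multiset.range (q * x + r)) 0 e' x (2 * (γ₀ + g₁ + g₂) + γ) := by
  obtain ⟨w, rfl⟩ := hxo
  obtain ⟨ρ, rfl⟩ := hre
  obtain ⟨e', h'⟩ := exists_triPath_three_columns hr hr4 he
  have h := exists_triPath_down (lo := 4) hr (by omega) (by omega) (by omega) (by omega)
    (by omega) h₁ h₂ hγ hg₁ hg₂
  have h'' := h.join h' (by simp [Nat.dist])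
  rw [add_right_comm, block_add (by omega) (by omega), block_add (by omega) (by omega),
    block_full (by omega)] at h''
  exact ⟨_, h''.congr rfl (by omega) (by omega)⟩

lemma TriPath.prepend {x y n e a c : ℕ} (h : TriPath x y (Multiset.range n) 0 e a c) :
    TriPath x y (Multiset.range (n + 1)) 0 (e + 1) (a + 1) c := by
  obtain ⟨b, h⟩ := h
  refine ⟨b, ?_⟩
  rw [← mset3_add_one]
  exact h.prepend

lemma TriPath.prepend_add {x y n e a c : ℕ} (h : TriPath x y (Multiset.range n) 0 e a c) (s : ℕ) :
    TriPath x y (Multiset.range (n + s)) 0 (e + s) (a + s) c := by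
  induction s with
  | zero => exact h
  | succ s ih => exact ih.prepend

/-- All steps `x` but `x` steps of length `1`. -/
lemma exists_triPath_two_lengths {x n : ℕ} (hx : 2 ≤ x) (hn : x ≤ n) :
    ∃ e, TriPath x (1 * x) (Multiset.range (n + 1)) 0 e x 0 := by
  obtain ⟨q, r, hq, hr, rfl⟩ : ∃ q r, 1 ≤ q ∧ r < x ∧ n = q * x + r :=
    ⟨n / x, n % x, Nat.div_pos hn (by omega), Nat.mod_lt _ (by omega), (Nat.div_add_mod' n x).symm⟩
  have hK := colCap_zero 1 hq
  have hK' := colCap_zero 1 (Nat.succ_pos q)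
  obtain ⟨e, he⟩ := hK 0 le_rfl
  have key : (∃ e, TriPath x (1 * x) (Multiset.range (q * x + r)) 0 e (x - 1) 0) →
      ∃ e, TriPath x (1 * x) (Multiset.range (q * x + r + 1)) 0 e x 0 := by
    rintro ⟨e, he⟩
    have := he.prepend
    rw [Nat.sub_add_cancel (by omega)] at this
    exact ⟨_, this⟩
  rcases Nat.even_or_odd r with hre | hro
  · apply key
    rcases Nat.even_or_odd x with hxe | hxo
    · have h := exists_triPath_of_even hx hq hr hre hK hK' (Nat.zero_le _)
      obtain ⟨w, rfl⟩ := hxe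
      rw [(by omega : 2 * ((w + w) / 2) = w + w), block_full (by omega)] at h
      exact ⟨_, h⟩
    · exact exists_triPath_odd_even hx hxo hq hr hre hK hK' (Nat.zero_le _) he
  · rcases Nat.even_or_odd x with hxe | hxo
    · apply key
      obtain ⟨w, rfl⟩ := hxe
      obtain ⟨ρ, rfl⟩ := hro
      have h := exists_triPath_down (x := w + w) (q := q) (r := 2 * ρ + 1) (lo := 1)
        (k₁ := w - 1 - ρ) (k₂ := ρ) hr (by omega) (by omega) (by omega) (by omega) (by omega)
        hK hK' le_rfl (Nat.zero_le _) (Nat.zero_le _)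
      rw [block_add (by omega) (by omega), block_full (by omega)] at h
      exact ⟨_, h.congr rfl (by omega) (by omega)⟩
    · obtain ⟨w, rfl⟩ := hxo
      obtain ⟨ρ, rfl⟩ := hro
      rcases Nat.eq_zero_or_pos ρ with rfl | hρ
      · apply key
        exact exists_triPath_odd_one (by omega) ⟨w, rfl⟩ hK le_rfl (Nat.zero_le _) he
      · exact exists_triPath_odd_extra (r := 2 * ρ + 1 + 1) ⟨w, rfl⟩ (by omega) (by omega)
          ⟨ρ + 1, by ring⟩ hK hK' le_rfl (Nat.zero_le _) (Nat.zero_le _) he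

lemma colCap_of_le {t m K : ℕ} (ht : 2 ≤ t) (h : K + t + 1 ≤ m) : ColCap t m K := by
  intro γ hγ
  obtain ⟨e, b, he⟩ := exists_triPath_two_lengths (n := t + γ) ht (by omega)
  have hc := he.card
  rw [Multiset.card_range, card_mset3] at hc
  obtain rfl : b = γ := by omega
  have h0 : TriPath 1 t (Multiset.range (t + b + 1)) 0 e 0 b := by
    refine ⟨t, ?_⟩
    convert he using 1
    simp [mset3]
  refine ⟨e + (m - (t + b + 1)), ?_⟩
  obtain ⟨s, rfl⟩ : ∃ s, m = t + b + 1 + s := ⟨m - (t + b + 1), by omega⟩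
  clear hc he hγ h
  rw [Nat.add_sub_cancel_left]
  induction s with
  | zero => exact h0
  | succ s ih => exact ColPath.prepend ih

lemma exists_eq_two_mul_add {c A M : ℕ} (h : c ≤ 2 * A + M) :
    ∃ g γ, g ≤ A ∧ c = 2 * g + γ ∧ (γ ≤ M ∨ γ = 1) := by
  rcases le_or_gt (c / 2) A with h' | h'
  · exact ⟨c / 2, c % 2, h', by omega, by omega⟩
  · exact ⟨A, c - 2 * A, le_rfl, by omega, by omega⟩

lemma exists_eq_add_of_le_add {g A B : ℕ} (h : g ≤ A + B) :
    ∃ g₁ g₂, g₁ ≤ A ∧ g₂ ≤ B ∧ g = g₁ + g₂ :=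
  ⟨min g A, g - min g A, by omega, by omega, by omega⟩

lemma exists_colPath {t M γ : ℕ} (ht : 2 ≤ t) (hγ : γ ≤ M ∨ γ = 1) :
    ∃ e, ColPath t (M + t + 1) γ e := by
  rcases le_or_gt γ M with h | h
  · exact colCap_of_le ht le_rfl γ h
  · obtain ⟨rfl, rfl⟩ : M = 0 ∧ γ = 1 := by omega
    rw [zero_add]
    exact colPath_one (by omega)

lemma TriPath.hasStandardLinearRealization {x y n e a b c : ℕ}
    (h : TriPath x y (Multiset.range n) 0 e a c) (hn : n = a + b + c + 1) :
    HasStandardLinearRealization (mset3 a b c x y) := by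
  obtain ⟨b', h⟩ := h
  have hc := h.card
  rw [Multiset.card_range, card_mset3] at hc
  obtain rfl : b' = b := by omega
  exact h.hasStandardLinearRealization

lemma exists_triPath_even_remainder {p t M r c : ℕ} (ht : 2 ≤ t) (hr : r < 2 * p + 3)
    (hre : Even r) (hc : c + 3 ≤ M * (2 * p + 1) + r) :
    ∃ e, TriPath (2 * p + 3) (t * (2 * p + 3))
      (Multiset.range ((M + t + 1) * (2 * p + 3) + r)) 0 e (2 * p + 2) c := by
  obtain ⟨g, γ, hg, rfl, hγ⟩ := exists_eq_two_mul_add (c := c) (M := M)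
    (A := (r / 2 - 1) * (M + 1) + ((2 * p + 3) / 2 - max (r / 2) 1) * M) (by
      obtain ⟨ρ, rfl⟩ := hre
      rw [(by omega : (ρ + ρ) / 2 = ρ), (by omega : (2 * p + 3) / 2 = p + 1)]
      rcases Nat.eq_zero_or_pos ρ with rfl | hρ
      · simp only [max_eq_right (Nat.zero_le 1), Nat.add_sub_cancel, Nat.zero_sub, zero_mul]
        nlinarith
      · rw [max_eq_left hρ]
        obtain ⟨σ, rfl⟩ : ∃ σ, ρ = σ + 1 := ⟨ρ - 1, by omega⟩
        obtain ⟨τ, rfl⟩ : ∃ τ, p = σ + τ := ⟨p - σ, by omega⟩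
        rw [Nat.add_sub_cancel, (by omega : σ + τ + 1 - (σ + 1) = τ)]
        nlinarith)
  obtain ⟨e, he⟩ := exists_colPath ht hγ
  exact exists_triPath_odd_even (by omega) ⟨p + 1, by ring⟩ (by omega) hr hre
    (colCap_of_le ht le_rfl) (colCap_of_le ht (by omega)) hg he

lemma exists_triPath_remainder_one {p t M c : ℕ} (ht : 2 ≤ t)
    (hc : c + 2 ≤ M * (2 * p + 1)) :
    ∃ e, TriPath (2 * p + 3) (t * (2 * p + 3))
      (Multiset.range ((M + t + 1) * (2 * p + 3) + 1)) 0 e (2 * p + 2) c := by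
  obtain ⟨g, γ, hg, rfl, hγ⟩ := exists_eq_two_mul_add (c := c) (M := M) (A := p * M)
    (by nlinarith)
  obtain ⟨e, he⟩ := exists_colPath ht hγ
  have := exists_triPath_odd_one (x := 2 * p + 3) (g := g) (by omega) ⟨p + 1, by ring⟩
    (colCap_of_le ht le_rfl) (Nat.zero_le M)
    (by rwa [(by omega : (2 * p + 3) / 2 - 1 = p)]) he
  rwa [zero_add] at this

lemma exists_triPath_odd_remainder {p t M r c : ℕ} (ht : 2 ≤ t) (hr : r < 2 * p + 3)
    (hr4 : 4 ≤ r) (hre : Even r) (hc : c + 4 ≤ M * (2 * p + 1) + r) :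
    ∃ e, TriPath (2 * p + 3) (t * (2 * p + 3))
      (Multiset.range ((M + t + 1) * (2 * p + 3) + r)) 0 e (2 * p + 3) c := by
  obtain ⟨g, γ, hg, rfl, hγ⟩ := exists_eq_two_mul_add (c := c) (M := M)
    (A := M + ((2 * p + 3 - r) / 2) * M + (r / 2 - 2) * (M + 1)) (by
      obtain ⟨ρ, rfl⟩ := hre
      obtain ⟨σ, rfl⟩ : ∃ σ, ρ = σ + 2 := ⟨ρ - 2, by omega⟩
      obtain ⟨τ, rfl⟩ : ∃ τ, p = σ + τ + 1 := ⟨p - σ - 1, by omega⟩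
      rw [(by omega : (2 * (σ + τ + 1) + 3 - (σ + 2 + (σ + 2))) / 2 = τ),
        (by omega : (σ + 2 + (σ + 2)) / 2 - 2 = σ)]
      nlinarith)
  obtain ⟨g', g₂, hg', hg₂, rfl⟩ := exists_eq_add_of_le_add hg
  obtain ⟨γ₀, g₁, hγ₀, hg₁, rfl⟩ := exists_eq_add_of_le_add hg'
  obtain ⟨e, he⟩ := exists_colPath ht hγ
  exact exists_triPath_odd_extra ⟨p + 1, by ring⟩ hr hr4 hre (colCap_of_le ht le_rfl)
    (colCap_of_le ht (by omega)) hγ₀ hg₁ hg₂ he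

/-- Let `x ≥ 3` be odd, `t ≥ 2`, `v = a + b + c + 1 ≥ (t+2)x` and
`q = ⌊v/x⌋`. If `a ≥ ω(x, b + c)` and `b ≥ 2q + tx - 2t + 1` then
`{1^a, x^b, (tx)^c}` has a standard linear realization. (The inequality on `b`
is written subtraction-free as `b + 2t ≥ 2q + tx + 1`.) -/
theorem stmt12 (x t a b c : ℕ) (hx : 3 ≤ x) (hxo : Odd x) (ht : 2 ≤ t)
    (hv : (t + 2) * x ≤ a + b + c + 1)
    (ha : omegaBHR x (b + c) ≤ a)
    (hb : 2 * ((a + b + c + 1) / x) + t * x + 1 ≤ b + 2 * t) :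
    HasStandardLinearRealization (mset3 a b c x (t * x)) := by
  obtain ⟨p, rfl⟩ : ∃ p, x = 2 * p + 3 := by
    obtain ⟨w, rfl⟩ := hxo
    exact ⟨w - 1, by omega⟩
  obtain ⟨Q, R, hR, hn, hQ, hR'⟩ : ∃ Q R, R < 2 * p + 3 ∧ b + c = Q * (2 * p + 3) + R ∧
      (b + c) / (2 * p + 3) = Q ∧ (b + c) % (2 * p + 3) = R :=
    ⟨_, _, Nat.mod_lt _ (by omega), (Nat.div_add_mod' _ _).symm, rfl, rfl⟩
  unfold omegaBHR at ha
  rw [hQ, hR'] at ha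
  have hxne : ¬ Even (2 * p + 3) := Nat.not_even_iff_odd.2 ⟨p + 1, by ring⟩
  have hax : 2 * p + 2 ≤ a := by split_ifs at ha <;> omega
  have hQ1 : Q + 1 ≤ (a + b + c + 1) / (2 * p + 3) := by
    rw [Nat.le_div_iff_mul_le (by omega)]
    nlinarith
  have hQt : t ≤ Q := by
    by_contra! h
    nlinarith [Nat.mul_le_mul_right (2 * p + 1) (Nat.succ_le_of_lt h)]
  obtain ⟨M, rfl⟩ : ∃ M, Q = M + t := ⟨Q - t, by omega⟩
  have hcM : c + 3 ≤ M * (2 * p + 1) + R := by nlinarith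
  split_ifs at ha with hω
  · obtain ⟨s, rfl⟩ : ∃ s, a = 2 * p + 2 + s := ⟨a - (2 * p + 2), by omega⟩
    obtain ⟨e, he⟩ : ∃ e, TriPath (2 * p + 3) (t * (2 * p + 3))
        (Multiset.range ((M + t + 1) * (2 * p + 3) + R)) 0 e (2 * p + 2) c := by
      rcases hω with h | rfl | h | h
      · omega
      · exact exists_triPath_remainder_one ht (by omega)
      · exact absurd h hxne
      · exact exists_triPath_even_remainder ht hR h hcM
    exact (he.prepend_add s).hasStandardLinearRealization (by nlinarith)
  · push Not at hω
    obtain ⟨s, rfl⟩ : ∃ s, a = 2 * p + 3 + s := ⟨a - (2 * p + 3), by omega⟩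
    obtain ⟨ρ, rfl⟩ := Nat.not_even_iff_odd.1 hω.2.2.2
    obtain ⟨e, he⟩ := exists_triPath_odd_remainder (M := M) (r := 2 * ρ + 1 + 1) (c := c)
      (p := p) ht (by omega) (by omega) ⟨ρ + 1, by ring⟩ (by omega)
    exact (he.prepend_add s).hasStandardLinearRealization (by nlinarith)
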